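/- Let Ψ be a smooth complex-valued function on Ω satisfying the Regge–Wheeler equation 𝕽⁽⁺²⁾Ψ = 0, and write 𝓛 = 𝓛⁽⁺²⁾. Then on Ω: (w⁻¹L̲)(w⁻¹L̲)( w² (w⁻¹L)(w⁻¹L)Ψ ) = (𝓛(𝓛−2) − 12M∂ₜ)Ψ and (w⁻¹L)(w⁻¹L)( w² (w⁻¹L̲)(w⁻¹L̲)Ψ ) = (𝓛(𝓛−2) + 12M∂ₜ)Ψ. -/

import Mathlib

/- Schwarzschild-Anti-de Sitter background: basic operators on functions
   u(t, r, ϑ, φ) with values in ℂ. -/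

noncomputable section

open Filter Topology Set

namespace Grav

abbrev F4 : Type := ℝ → ℝ → ℝ → ℝ → ℂ

/-- `Δ(r) = r² + k²r⁴ − 2Mr`. -/
def Del (M k r : ℝ) : ℝ := r ^ 2 + k ^ 2 * r ^ 4 - 2 * M * r

/-- `∂ₜ`. -/
def dT (u : F4) : F4 := fun t r ϑ φ => deriv (fun s => u s r ϑ φ) t
/-- `∂ᵣ`. -/
def dR (u : F4) : F4 := fun t r ϑ φ => deriv (fun s => u t s ϑ φ) r
/-- `∂_ϑ`. -/
def dTh (u : F4) : F4 := fun t r ϑ φ => deriv (fun s => u t r s φ) ϑ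
/-- `∂_φ`. -/
def dPh (u : F4) : F4 := fun t r ϑ φ => deriv (fun s => u t r ϑ s) φ

/-- `L u = ∂ₜ u + (Δ/r²) ∂ᵣ u`. -/
def opL (M k : ℝ) (u : F4) : F4 := fun t r ϑ φ =>
  dT u t r ϑ φ + ((Del M k r / r ^ 2 : ℝ) : ℂ) * dR u t r ϑ φ

/-- `L̲ u = ∂ₜ u − (Δ/r²) ∂ᵣ u`. -/
def opLb (M k : ℝ) (u : F4) : F4 := fun t r ϑ φ =>
  dT u t r ϑ φ - ((Del M k r / r ^ 2 : ℝ) : ℂ) * dR u t r ϑ φ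

/-- `w = Δ/r⁴`. -/
def ww (M k r : ℝ) : ℝ := Del M k r / r ^ 4
/-- `w′ = w·(6M − 2r)/r²`. -/
def wwP (M k r : ℝ) : ℝ := ww M k r * (6 * M - 2 * r) / r ^ 2

/-- The angular operator `𝓛⁽⁺²⁾`. -/
def angP (u : F4) : F4 := fun t r ϑ φ =>
  -(Real.sin ϑ : ℂ)⁻¹ * deriv (fun x => (Real.sin x : ℂ) * dTh u t r x φ) ϑ
  - (((Real.sin ϑ) ^ 2 : ℝ) : ℂ)⁻¹ * dPh (dPh u) t r ϑ φ
  - 4 * Complex.I * ((Real.cos ϑ / (Real.sin ϑ) ^ 2 : ℝ) : ℂ) * dPh u t r ϑ φ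
  + 4 * (((Real.cos ϑ / Real.sin ϑ) ^ 2 : ℝ) : ℂ) * u t r ϑ φ
  + 4 * u t r ϑ φ

/-- The angular operator `𝓛⁽⁻²⁾`. -/
def angM (u : F4) : F4 := fun t r ϑ φ =>
  -(Real.sin ϑ : ℂ)⁻¹ * deriv (fun x => (Real.sin x : ℂ) * dTh u t r x φ) ϑ
  - (((Real.sin ϑ) ^ 2 : ℝ) : ℂ)⁻¹ * dPh (dPh u) t r ϑ φ
  + 4 * Complex.I * ((Real.cos ϑ / (Real.sin ϑ) ^ 2 : ℝ) : ℂ) * dPh u t r ϑ φ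
  + 4 * (((Real.cos ϑ / Real.sin ϑ) ^ 2 : ℝ) : ℂ) * u t r ϑ φ
  + 4 * u t r ϑ φ

/-- The Teukolsky operator `𝔗⁽⁺²⁾u = −LL̲u + 2(w′/w)L̲u − w(𝓛⁽⁺²⁾ − 2 + 6M/r)u`. -/
def Tp (M k : ℝ) (u : F4) : F4 := fun t r ϑ φ =>
  - opL M k (opLb M k u) t r ϑ φ
  + 2 * ((wwP M k r / ww M k r : ℝ) : ℂ) * opLb M k u t r ϑ φ
  - ((ww M k r : ℝ) : ℂ) *
      (angP u t r ϑ φ - 2 * u t r ϑ φ + ((6 * M / r : ℝ) : ℂ) * u t r ϑ φ)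

/-- The Teukolsky operator `𝔗⁽⁻²⁾u = −LL̲u − 2(w′/w)Lu − w(𝓛⁽⁻²⁾ − 2 + 6M/r)u`. -/
def Tm (M k : ℝ) (u : F4) : F4 := fun t r ϑ φ =>
  - opL M k (opLb M k u) t r ϑ φ
  - 2 * ((wwP M k r / ww M k r : ℝ) : ℂ) * opL M k u t r ϑ φ
  - ((ww M k r : ℝ) : ℂ) *
      (angM u t r ϑ φ - 2 * u t r ϑ φ + ((6 * M / r : ℝ) : ℂ) * u t r ϑ φ)

/-- The Regge–Wheeler operator `𝕽⁽⁺²⁾u = −LL̲u − w(𝓛⁽⁺²⁾ − 6M/r)u`. -/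
def RWp (M k : ℝ) (u : F4) : F4 := fun t r ϑ φ =>
  - opL M k (opLb M k u) t r ϑ φ
  - ((ww M k r : ℝ) : ℂ) * (angP u t r ϑ φ - ((6 * M / r : ℝ) : ℂ) * u t r ϑ φ)

/-- The Regge–Wheeler operator `𝕽⁽⁻²⁾u = −LL̲u − w(𝓛⁽⁻²⁾ − 6M/r)u`. -/
def RWm (M k : ℝ) (u : F4) : F4 := fun t r ϑ φ =>
  - opL M k (opLb M k u) t r ϑ φ
  - ((ww M k r : ℝ) : ℂ) * (angM u t r ϑ φ - ((6 * M / r : ℝ) : ℂ) * u t r ϑ φ)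

/-- The exterior region `Ω = {r > r₊, 0 < ϑ < π}` (as a subset of ℝ⁴). -/
def OmSet (rp : ℝ) : Set (ℝ × ℝ × ℝ × ℝ) :=
  {p | rp < p.2.1 ∧ 0 < p.2.2.1 ∧ p.2.2.1 < Real.pi}

/-- `u` is smooth on `Ω`. -/
def SmoothOnOm (rp : ℝ) (u : F4) : Prop :=
  ContDiffOn ℝ (⊤ : ℕ∞)
    (fun p : ℝ × ℝ × ℝ × ℝ => u p.1 p.2.1 p.2.2.1 p.2.2.2) (OmSet rp)

/-- Multiplication by `w⁻¹`. -/
def winv (M k : ℝ) (u : F4) : F4 := fun t r ϑ φ => ((ww M k r : ℝ) : ℂ)⁻¹ * u t r ϑ φ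
/-- Multiplication by `w`. -/
def wmul (M k : ℝ) (u : F4) : F4 := fun t r ϑ φ => ((ww M k r : ℝ) : ℂ) * u t r ϑ φ
/-- Pointwise complex conjugation. -/
def conjF (u : F4) : F4 := fun t r ϑ φ => (starRingEnd ℂ) (u t r ϑ φ)

/-- `𝓛⁽⁺²⁾(𝓛⁽⁺²⁾ − 2)`. -/
def angSqP (u : F4) : F4 := angP (fun t r ϑ φ => angP u t r ϑ φ - 2 * u t r ϑ φ)
/-- `𝓛⁽⁻²⁾(𝓛⁽⁻²⁾ − 2)`. -/
def angSqM (u : F4) : F4 := angM (fun t r ϑ φ => angM u t r ϑ φ - 2 * u t r ϑ φ)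

/-- `𝓛⁽⁺²⁾(𝓛⁽⁺²⁾ − 2) + 12M∂ₜ`. -/
def TSp (M : ℝ) (u : F4) : F4 := fun t r ϑ φ =>
  angSqP u t r ϑ φ + 12 * (M : ℂ) * dT u t r ϑ φ
/-- `𝓛⁽⁻²⁾(𝓛⁽⁻²⁾ − 2) − 12M∂ₜ`. -/
def TSm (M : ℝ) (u : F4) : F4 := fun t r ϑ φ =>
  angSqM u t r ϑ φ - 12 * (M : ℂ) * dT u t r ϑ φ

section DirectionalDerivative

variable {E : Type*} [NormedAddCommGroup E] [NormedSpace ℝ E] {s : Set E} {X Y : E → E}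
  {U V : E → ℂ} {p : E}

/-- The derivative of `U` along the vector field `X`. -/
def dirD (X : E → E) (U : E → ℂ) : E → ℂ := fun p => fderiv ℝ U p (X p)

theorem dirD_congr (hs : IsOpen s) (h : EqOn U V s) : EqOn (dirD X U) (dirD X V) s := fun p hp => by
  simp only [dirD]
  rw [(h.eventuallyEq_of_mem (hs.mem_nhds hp)).fderiv_eq]

theorem dirD_contDiffOn (hs : IsOpen s) (hX : ContDiffOn ℝ (⊤ : ℕ∞) X s)
    (hU : ContDiffOn ℝ (⊤ : ℕ∞) U s) : ContDiffOn ℝ (⊤ : ℕ∞) (dirD X U) s :=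
  (hU.fderiv_of_isOpen hs (by norm_cast)).clm_apply hX

theorem differentiableAt_of_smoothOn {F : Type*} [NormedAddCommGroup F] [NormedSpace ℝ F]
    {f : E → F} (hs : IsOpen s) (hf : ContDiffOn ℝ (⊤ : ℕ∞) f s) (hp : p ∈ s) :
    DifferentiableAt ℝ f p :=
  (hf.contDiffAt (hs.mem_nhds hp)).differentiableAt (by simp)

theorem smoothOn_mul (hU : ContDiffOn ℝ (⊤ : ℕ∞) U s) (hV : ContDiffOn ℝ (⊤ : ℕ∞) V s) :
    ContDiffOn ℝ (⊤ : ℕ∞) (U * V) s := hU.mul hV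

theorem smoothOn_sub (hU : ContDiffOn ℝ (⊤ : ℕ∞) U s) (hV : ContDiffOn ℝ (⊤ : ℕ∞) V s) :
    ContDiffOn ℝ (⊤ : ℕ∞) (U - V) s := hU.sub hV

theorem smoothOn_const_smul (c : ℂ) (hU : ContDiffOn ℝ (⊤ : ℕ∞) U s) :
    ContDiffOn ℝ (⊤ : ℕ∞) (c • U) s := contDiffOn_const.smul hU

theorem dirD_mul (hs : IsOpen s) (hU : ContDiffOn ℝ (⊤ : ℕ∞) U s)
    (hV : ContDiffOn ℝ (⊤ : ℕ∞) V s) (hp : p ∈ s) :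
    dirD X (U * V) p = U p * dirD X V p + dirD X U p * V p := by
  simp only [dirD]
  rw [fderiv_mul (differentiableAt_of_smoothOn hs hU hp) (differentiableAt_of_smoothOn hs hV hp)]
  simp [mul_comm]

theorem dirD_add (hs : IsOpen s) (hU : ContDiffOn ℝ (⊤ : ℕ∞) U s)
    (hV : ContDiffOn ℝ (⊤ : ℕ∞) V s) (hp : p ∈ s) :
    dirD X (U + V) p = dirD X U p + dirD X V p := by
  simp only [dirD]
  rw [fderiv_add (differentiableAt_of_smoothOn hs hU hp) (differentiableAt_of_smoothOn hs hV hp)]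
  rfl

theorem dirD_sub (hs : IsOpen s) (hU : ContDiffOn ℝ (⊤ : ℕ∞) U s)
    (hV : ContDiffOn ℝ (⊤ : ℕ∞) V s) (hp : p ∈ s) :
    dirD X (U - V) p = dirD X U p - dirD X V p := by
  simp only [dirD]
  rw [fderiv_sub (differentiableAt_of_smoothOn hs hU hp) (differentiableAt_of_smoothOn hs hV hp)]
  rfl

theorem dirD_neg : dirD X (-U) p = -dirD X U p := by
  simp [dirD, fderiv_neg]

theorem dirD_const_smul (c : ℂ) (hs : IsOpen s) (hU : ContDiffOn ℝ (⊤ : ℕ∞) U s) (hp : p ∈ s) :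
    dirD X (c • U) p = c * dirD X U p := by
  simp only [dirD]
  rw [fderiv_const_smul (differentiableAt_of_smoothOn hs hU hp)]
  rfl

theorem dirD_dirD (hs : IsOpen s) (hY : ContDiffOn ℝ (⊤ : ℕ∞) Y s)
    (hU : ContDiffOn ℝ (⊤ : ℕ∞) U s) (hp : p ∈ s) :
    dirD X (dirD Y U) p
      = fderiv ℝ (fderiv ℝ U) p (X p) (Y p) + fderiv ℝ U p (fderiv ℝ Y p (X p)) := by
  have h1 : ContDiffOn ℝ (⊤ : ℕ∞) (fderiv ℝ U) s := hU.fderiv_of_isOpen hs (by norm_cast)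
  have h2 := ((differentiableAt_of_smoothOn hs h1 hp).hasFDerivAt.clm_apply
    (differentiableAt_of_smoothOn hs hY hp).hasFDerivAt).fderiv
  change fderiv ℝ (fun q => fderiv ℝ U q (Y q)) p (X p) = _
  rw [h2]
  simp [add_comm]

/-- Derivatives along vector fields with vanishing Lie bracket commute. -/
theorem dirD_comm (hs : IsOpen s) (hX : ContDiffOn ℝ (⊤ : ℕ∞) X s)
    (hY : ContDiffOn ℝ (⊤ : ℕ∞) Y s)
    (hXY : ∀ p ∈ s, fderiv ℝ Y p (X p) = fderiv ℝ X p (Y p))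
    (hU : ContDiffOn ℝ (⊤ : ℕ∞) U s) : EqOn (dirD X (dirD Y U)) (dirD Y (dirD X U)) s := by
  intro p hp
  have hsymm : IsSymmSndFDerivAt ℝ U p :=
    (hU.contDiffAt (hs.mem_nhds hp)).isSymmSndFDerivAt
      (by simpa using WithTop.coe_le_coe.2 (le_top : (2 : ℕ∞) ≤ ⊤))
  rw [dirD_dirD hs hY hU hp, dirD_dirD hs hX hU hp, hXY p hp, hsymm (X p) (Y p)]

end DirectionalDerivative

/-- The function of a point of `ℝ⁴` given by a function of four real variables. -/
def unc (u : F4) : ℝ × ℝ × ℝ × ℝ → ℂ := fun p => u p.1 p.2.1 p.2.2.1 p.2.2.2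

theorem unc_apply (u : F4) (t r ϑ φ : ℝ) : unc u (t, r, ϑ, φ) = u t r ϑ φ := rfl

/-- A function of the radial coordinate. -/
def radial (g : ℝ → ℝ) : ℝ × ℝ × ℝ × ℝ → ℂ := fun p => (g p.2.1 : ℂ)

/-- A function of the polar angle. -/
def polar (g : ℝ → ℝ) : ℝ × ℝ × ℝ × ℝ → ℂ := fun p => (g p.2.2.1 : ℂ)

/-- The vector field `∂ₜ`. -/
def vT : ℝ × ℝ × ℝ × ℝ → ℝ × ℝ × ℝ × ℝ := fun _ => (1, 0, 0, 0)
/-- The vector field `∂ᵣ`. -/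
def vR : ℝ × ℝ × ℝ × ℝ → ℝ × ℝ × ℝ × ℝ := fun _ => (0, 1, 0, 0)
/-- The vector field `∂_ϑ`. -/
def vTh : ℝ × ℝ × ℝ × ℝ → ℝ × ℝ × ℝ × ℝ := fun _ => (0, 0, 1, 0)
/-- The vector field `∂_φ`. -/
def vPh : ℝ × ℝ × ℝ × ℝ → ℝ × ℝ × ℝ × ℝ := fun _ => (0, 0, 0, 1)

/-- The vector field `∂ₜ + σ(Δ/r²)∂ᵣ`, equal to `L` for `σ = 1` and to `L̲` for `σ = -1`. -/
def vNull (M k σ : ℝ) : ℝ × ℝ × ℝ × ℝ → ℝ × ℝ × ℝ × ℝ :=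
  fun p => (1, σ * (Del M k p.2.1 / p.2.1 ^ 2), 0, 0)

/-- The operator `𝓛⁽⁺²⁾` on functions on `ℝ⁴`. -/
def ang (U : ℝ × ℝ × ℝ × ℝ → ℂ) : ℝ × ℝ × ℝ × ℝ → ℂ :=
  -polar (fun x => (Real.sin x)⁻¹) * dirD vTh (polar Real.sin * dirD vTh U)
  - polar (fun x => (Real.sin x ^ 2)⁻¹) * dirD vPh (dirD vPh U)
  - (4 * Complex.I) • (polar (fun x => Real.cos x / Real.sin x ^ 2) * dirD vPh U)
  + polar (fun x => 4 * (Real.cos x / Real.sin x) ^ 2 + 4) * U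

section Exterior

variable {M k rp σ : ℝ} {u : F4} {U V : ℝ × ℝ × ℝ × ℝ → ℂ} {g : ℝ → ℝ} {p : ℝ × ℝ × ℝ × ℝ}

theorem isOpen_OmSet (rp : ℝ) : IsOpen (OmSet rp) := by
  have hr : Continuous fun p : ℝ × ℝ × ℝ × ℝ => p.2.1 := by fun_prop
  have hϑ : Continuous fun p : ℝ × ℝ × ℝ × ℝ => p.2.2.1 := by fun_prop
  exact (isOpen_lt continuous_const hr).inter
    ((isOpen_lt continuous_const hϑ).inter (isOpen_lt hϑ continuous_const))

theorem contDiffOn_radial (hg : ContDiffOn ℝ (⊤ : ℕ∞) g (Ioi rp)) :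
    ContDiffOn ℝ (⊤ : ℕ∞) (radial g) (OmSet rp) :=
  Complex.ofRealCLM.contDiff.comp_contDiffOn
    (hg.comp (by fun_prop : ContDiffOn ℝ (⊤ : ℕ∞) (fun p : ℝ × ℝ × ℝ × ℝ => p.2.1) _)
      fun _ hp => hp.1)

theorem contDiffOn_polar (hg : ContDiffOn ℝ (⊤ : ℕ∞) g (Ioo 0 Real.pi)) :
    ContDiffOn ℝ (⊤ : ℕ∞) (polar g) (OmSet rp) :=
  Complex.ofRealCLM.contDiff.comp_contDiffOn
    (hg.comp (by fun_prop : ContDiffOn ℝ (⊤ : ℕ∞) (fun p : ℝ × ℝ × ℝ × ℝ => p.2.2.1) _)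
      fun _ hp => hp.2)

theorem dirD_radial {X : ℝ × ℝ × ℝ × ℝ → ℝ × ℝ × ℝ × ℝ} {g' : ℝ} (hg : HasDerivAt g g' p.2.1) :
    dirD X (radial g) p = (g' * (X p).2.1 : ℝ) := by
  have h := Complex.ofRealCLM.hasFDerivAt.comp p
    (hg.hasFDerivAt.comp p (hasFDerivAt_snd (𝕜 := ℝ) (p := p) |>.fst))
  have h' : fderiv ℝ (radial g) p = _ := h.fderiv
  simp only [dirD, h']
  simp [mul_comm]

theorem dirD_polar {X : ℝ × ℝ × ℝ × ℝ → ℝ × ℝ × ℝ × ℝ} {g' : ℝ} (hg : HasDerivAt g g' p.2.2.1) :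
    dirD X (polar g) p = (g' * (X p).2.2.1 : ℝ) := by
  have h := Complex.ofRealCLM.hasFDerivAt.comp p
    (hg.hasFDerivAt.comp p (hasFDerivAt_snd (𝕜 := ℝ) (p := p) |>.snd |>.fst))
  have h' : fderiv ℝ (polar g) p = _ := h.fderiv
  simp only [dirD, h']
  simp [mul_comm]

theorem dirD_radial_mul {X : ℝ × ℝ × ℝ × ℝ → ℝ × ℝ × ℝ × ℝ} {g' : ℝ}
    (hg : ContDiffOn ℝ (⊤ : ℕ∞) g (Ioi rp)) (hg' : HasDerivAt g g' p.2.1)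
    (hU : ContDiffOn ℝ (⊤ : ℕ∞) U (OmSet rp)) (hp : p ∈ OmSet rp) :
    dirD X (radial g * U) p = radial g p * dirD X U p + (g' * (X p).2.1 : ℝ) * U p := by
  rw [dirD_mul (isOpen_OmSet rp) (contDiffOn_radial hg) hU hp, dirD_radial hg']

theorem dirD_radial_mul_of_angular {X : ℝ × ℝ × ℝ × ℝ → ℝ × ℝ × ℝ × ℝ}
    (hX : ∀ p, (X p).2.1 = 0) (hg : ContDiffOn ℝ (⊤ : ℕ∞) g (Ioi rp))
    (hU : ContDiffOn ℝ (⊤ : ℕ∞) U (OmSet rp)) :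
    EqOn (dirD X (radial g * U)) (radial g * dirD X U) (OmSet rp) := fun p hp => by
  have h := (differentiableAt_of_smoothOn isOpen_Ioi hg hp.1).hasDerivAt
  simp [dirD_radial_mul hg h hU hp, hX]

theorem dirD_polar_mul {X : ℝ × ℝ × ℝ × ℝ → ℝ × ℝ × ℝ × ℝ} (hX : ∀ p, (X p).2.2.1 = 0)
    (hg : ContDiffOn ℝ (⊤ : ℕ∞) g (Ioo 0 Real.pi))
    (hU : ContDiffOn ℝ (⊤ : ℕ∞) U (OmSet rp)) :
    EqOn (dirD X (polar g * U)) (polar g * dirD X U) (OmSet rp) := fun p hp => by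
  have h := (differentiableAt_of_smoothOn isOpen_Ioo hg hp.2).hasDerivAt
  rw [dirD_mul (isOpen_OmSet rp) (contDiffOn_polar hg) hU hp, dirD_polar h]
  simp [hX]

theorem contDiffOn_vTh : ContDiffOn ℝ (⊤ : ℕ∞) vTh (OmSet rp) := contDiffOn_const
theorem contDiffOn_vPh : ContDiffOn ℝ (⊤ : ℕ∞) vPh (OmSet rp) := contDiffOn_const

theorem contDiffOn_lapse (hrp : 0 < rp) :
    ContDiffOn ℝ (⊤ : ℕ∞) (fun r => Del M k r / r ^ 2) (Ioi rp) := by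
  unfold Del
  exact ContDiffOn.div (by fun_prop) (by fun_prop)
    fun r hr => pow_ne_zero 2 (hrp.trans hr).ne'

theorem contDiffOn_vNull (hrp : 0 < rp) :
    ContDiffOn ℝ (⊤ : ℕ∞) (vNull M k σ) (OmSet rp) :=
  contDiffOn_const.prodMk ((contDiffOn_const.mul ((contDiffOn_lapse hrp).comp
    (by fun_prop : ContDiffOn ℝ (⊤ : ℕ∞) (fun p : ℝ × ℝ × ℝ × ℝ => p.2.1) _)
      fun _ hp => hp.1)).prodMk contDiffOn_const)

theorem fderiv_vNull (hrp : 0 < rp) (hp : p ∈ OmSet rp) (v : ℝ × ℝ × ℝ × ℝ) :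
    fderiv ℝ (vNull M k σ) p v
      = (0, σ * (deriv (fun r => Del M k r / r ^ 2) p.2.1 * v.2.1), 0, 0) := by
  have h0 := (differentiableAt_of_smoothOn isOpen_Ioi
    (contDiffOn_lapse (M := M) (k := k) hrp) hp.1).hasDerivAt
  have h1 := h0.hasFDerivAt.comp p (hasFDerivAt_snd (𝕜 := ℝ) (p := p) |>.fst)
  have h2 := (hasFDerivAt_const (1 : ℝ) p).prodMk ((h1.const_mul σ).prodMk
    (hasFDerivAt_const ((0, 0) : ℝ × ℝ) p))
  have h3 : fderiv ℝ (vNull M k σ) p = _ := h2.fderiv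
  rw [h3]
  simp [mul_comm, Prod.zero_eq_mk]

theorem dirD_vNull_comm (hrp : 0 < rp) {τ : ℝ} (hU : ContDiffOn ℝ (⊤ : ℕ∞) U (OmSet rp)) :
    EqOn (dirD (vNull M k σ) (dirD (vNull M k τ) U))
      (dirD (vNull M k τ) (dirD (vNull M k σ) U)) (OmSet rp) := by
  refine dirD_comm (isOpen_OmSet rp) (contDiffOn_vNull hrp) (contDiffOn_vNull hrp)
    (fun p hp => ?_) hU
  simp only [fderiv_vNull hrp hp, vNull, Prod.mk.injEq, and_true, true_and]
  ring

theorem dirD_vNull_vTh_comm (hrp : 0 < rp) (hU : ContDiffOn ℝ (⊤ : ℕ∞) U (OmSet rp)) :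
    EqOn (dirD (vNull M k σ) (dirD vTh U)) (dirD vTh (dirD (vNull M k σ) U)) (OmSet rp) := by
  refine dirD_comm (isOpen_OmSet rp) (contDiffOn_vNull hrp) contDiffOn_vTh (fun p hp => ?_) hU
  have h : fderiv ℝ vTh p = 0 := fderiv_const_apply _
  simp [fderiv_vNull hrp hp, h, vTh, Prod.zero_eq_mk]

theorem dirD_vNull_vPh_comm (hrp : 0 < rp) (hU : ContDiffOn ℝ (⊤ : ℕ∞) U (OmSet rp)) :
    EqOn (dirD (vNull M k σ) (dirD vPh U)) (dirD vPh (dirD (vNull M k σ) U)) (OmSet rp) := by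
  refine dirD_comm (isOpen_OmSet rp) (contDiffOn_vNull hrp) contDiffOn_vPh (fun p hp => ?_) hU
  have h : fderiv ℝ vPh p = 0 := fderiv_const_apply _
  simp [fderiv_vNull hrp hp, h, vPh, Prod.zero_eq_mk]

theorem contDiffOn_dTh (hU : ContDiffOn ℝ (⊤ : ℕ∞) U (OmSet rp)) :
    ContDiffOn ℝ (⊤ : ℕ∞) (dirD vTh U) (OmSet rp) :=
  dirD_contDiffOn (isOpen_OmSet rp) contDiffOn_vTh hU

theorem contDiffOn_dPh (hU : ContDiffOn ℝ (⊤ : ℕ∞) U (OmSet rp)) :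
    ContDiffOn ℝ (⊤ : ℕ∞) (dirD vPh U) (OmSet rp) :=
  dirD_contDiffOn (isOpen_OmSet rp) contDiffOn_vPh hU

theorem contDiffOn_dNull (hrp : 0 < rp) (hU : ContDiffOn ℝ (⊤ : ℕ∞) U (OmSet rp)) :
    ContDiffOn ℝ (⊤ : ℕ∞) (dirD (vNull M k σ) U) (OmSet rp) :=
  dirD_contDiffOn (isOpen_OmSet rp) (contDiffOn_vNull hrp) hU

theorem contDiffOn_sin : ContDiffOn ℝ (⊤ : ℕ∞) Real.sin (Ioo 0 Real.pi) :=
  Real.contDiff_sin.contDiffOn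

theorem contDiffOn_inv_sin :
    ContDiffOn ℝ (⊤ : ℕ∞) (fun x => (Real.sin x)⁻¹) (Ioo 0 Real.pi) :=
  contDiffOn_sin.inv fun _ hx => (Real.sin_pos_of_mem_Ioo hx).ne'

theorem contDiffOn_inv_sin_sq :
    ContDiffOn ℝ (⊤ : ℕ∞) (fun x => (Real.sin x ^ 2)⁻¹) (Ioo 0 Real.pi) :=
  (contDiffOn_sin.pow 2).inv fun _ hx => pow_ne_zero 2 (Real.sin_pos_of_mem_Ioo hx).ne'

theorem contDiffOn_cos_div_sin_sq :
    ContDiffOn ℝ (⊤ : ℕ∞) (fun x => Real.cos x / Real.sin x ^ 2) (Ioo 0 Real.pi) :=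
  Real.contDiff_cos.contDiffOn.div (contDiffOn_sin.pow 2)
    fun _ hx => pow_ne_zero 2 (Real.sin_pos_of_mem_Ioo hx).ne'

theorem contDiffOn_ang_potential :
    ContDiffOn ℝ (⊤ : ℕ∞) (fun x => 4 * (Real.cos x / Real.sin x) ^ 2 + 4) (Ioo 0 Real.pi) :=
  (contDiffOn_const.mul ((Real.contDiff_cos.contDiffOn.div contDiffOn_sin
    fun _ hx => (Real.sin_pos_of_mem_Ioo hx).ne').pow 2)).add contDiffOn_const

theorem ang_congr (h : EqOn U V (OmSet rp)) : EqOn (ang U) (ang V) (OmSet rp) := fun p hp => by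
  have hs := isOpen_OmSet rp
  have hTh : EqOn (dirD vTh U) (dirD vTh V) (OmSet rp) := dirD_congr hs h
  have hPh : EqOn (dirD vPh U) (dirD vPh V) (OmSet rp) := dirD_congr hs h
  have hThTh : EqOn (polar Real.sin * dirD vTh U) (polar Real.sin * dirD vTh V) (OmSet rp) :=
    fun q hq => by simp [hTh hq]
  have h1 := dirD_congr (X := vTh) hs hThTh hp
  have h2 := dirD_congr (X := vPh) hs hPh hp
  simp [ang, h1, h2, hPh hp, h hp]

/-- The four summands of `ang U` are smooth. -/
theorem contDiffOn_ang_terms (hU : ContDiffOn ℝ (⊤ : ℕ∞) U (OmSet rp)) :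
    ContDiffOn ℝ (⊤ : ℕ∞) (-polar (fun x => (Real.sin x)⁻¹) *
      dirD vTh (polar Real.sin * dirD vTh U)) (OmSet rp) ∧
    ContDiffOn ℝ (⊤ : ℕ∞) (polar (fun x => (Real.sin x ^ 2)⁻¹) * dirD vPh (dirD vPh U))
      (OmSet rp) ∧
    ContDiffOn ℝ (⊤ : ℕ∞) (polar (fun x => Real.cos x / Real.sin x ^ 2) * dirD vPh U)
      (OmSet rp) ∧
    ContDiffOn ℝ (⊤ : ℕ∞) (polar (fun x => 4 * (Real.cos x / Real.sin x) ^ 2 + 4) * U)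
      (OmSet rp) :=
  ⟨(contDiffOn_polar contDiffOn_inv_sin).neg.mul
      (contDiffOn_dTh (smoothOn_mul (contDiffOn_polar contDiffOn_sin) (contDiffOn_dTh hU))),
    (contDiffOn_polar contDiffOn_inv_sin_sq).mul (contDiffOn_dPh (contDiffOn_dPh hU)),
    (contDiffOn_polar contDiffOn_cos_div_sin_sq).mul (contDiffOn_dPh hU),
    (contDiffOn_polar contDiffOn_ang_potential).mul hU⟩

theorem contDiffOn_ang (hU : ContDiffOn ℝ (⊤ : ℕ∞) U (OmSet rp)) :
    ContDiffOn ℝ (⊤ : ℕ∞) (ang U) (OmSet rp) := by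
  obtain ⟨h1, h2, h3, h4⟩ := contDiffOn_ang_terms hU
  exact (smoothOn_sub (smoothOn_sub h1 h2) (smoothOn_const_smul _ h3)).add h4

theorem ang_sub (hU : ContDiffOn ℝ (⊤ : ℕ∞) U (OmSet rp))
    (hV : ContDiffOn ℝ (⊤ : ℕ∞) V (OmSet rp)) :
    EqOn (ang (U - V)) (ang U - ang V) (OmSet rp) := fun p hp => by
  have hs := isOpen_OmSet rp
  have hTh : EqOn (polar Real.sin * dirD vTh (U - V))
      (polar Real.sin * dirD vTh U - polar Real.sin * dirD vTh V) (OmSet rp) := fun q hq => by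
    simp [dirD_sub hs hU hV hq, mul_sub]
  have hPh : EqOn (dirD vPh (U - V)) (dirD vPh U - dirD vPh V) (OmSet rp) := fun q hq =>
    dirD_sub hs hU hV hq
  have hsin := contDiffOn_polar (rp := rp) contDiffOn_sin
  have h1 := dirD_congr (X := vTh) hs hTh hp
  rw [dirD_sub hs (smoothOn_mul hsin (contDiffOn_dTh hU))
    (smoothOn_mul hsin (contDiffOn_dTh hV)) hp] at h1
  have h2 := dirD_congr (X := vPh) hs hPh hp
  rw [dirD_sub hs (contDiffOn_dPh hU) (contDiffOn_dPh hV) hp] at h2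
  simp only [ang, Pi.add_apply, Pi.sub_apply, Pi.mul_apply, Pi.smul_apply, smul_eq_mul, h1, h2,
    hPh hp]
  ring

theorem ang_radial_mul (hg : ContDiffOn ℝ (⊤ : ℕ∞) g (Ioi rp))
    (hU : ContDiffOn ℝ (⊤ : ℕ∞) U (OmSet rp)) :
    EqOn (ang (radial g * U)) (radial g * ang U) (OmSet rp) := fun p hp => by
  have hs := isOpen_OmSet rp
  have hTh : EqOn (polar Real.sin * dirD vTh (radial g * U))
      (radial g * (polar Real.sin * dirD vTh U)) (OmSet rp) := fun q hq => by
    have h := dirD_radial_mul_of_angular (X := vTh) (fun _ => rfl) hg hU hq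
    simp only [Pi.mul_apply, h]
    ring
  have hPh := dirD_radial_mul_of_angular (X := vPh) (fun _ => rfl) hg hU
  have h1 := (dirD_congr (X := vTh) hs hTh hp).trans (dirD_radial_mul_of_angular
    (fun _ => rfl) hg (smoothOn_mul (contDiffOn_polar contDiffOn_sin) (contDiffOn_dTh hU)) hp)
  have h2 := (dirD_congr (X := vPh) hs hPh hp).trans (dirD_radial_mul_of_angular
    (fun _ => rfl) hg (contDiffOn_dPh hU) hp)
  simp only [ang, Pi.add_apply, Pi.sub_apply, Pi.mul_apply, Pi.smul_apply, smul_eq_mul, h1, h2,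
    hPh hp]
  ring

theorem dirD_vNull_ang (hrp : 0 < rp) (hU : ContDiffOn ℝ (⊤ : ℕ∞) U (OmSet rp)) :
    EqOn (dirD (vNull M k σ) (ang U)) (ang (dirD (vNull M k σ) U)) (OmSet rp) := fun p hp => by
  have hs := isOpen_OmSet rp
  obtain ⟨h1, h2, h3, h4⟩ := contDiffOn_ang_terms hU
  have hX : ∀ p, (vNull M k σ p).2.2.1 = 0 := fun _ => rfl
  have hdTh := contDiffOn_dTh hU
  have hdPh := contDiffOn_dPh hU
  have hsdTh := smoothOn_mul (contDiffOn_polar contDiffOn_sin) hdTh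
  have hTh : EqOn (dirD (vNull M k σ) (polar Real.sin * dirD vTh U))
      (polar Real.sin * dirD vTh (dirD (vNull M k σ) U)) (OmSet rp) := fun q hq => by
    rw [dirD_polar_mul hX contDiffOn_sin hdTh hq]
    simp [dirD_vNull_vTh_comm hrp hU hq]
  have hThTh := (dirD_vNull_vTh_comm (M := M) (k := k) (σ := σ) hrp hsdTh hp).trans
    (dirD_congr hs hTh hp)
  have hPh := dirD_vNull_vPh_comm (M := M) (k := k) (σ := σ) hrp hU
  have hPhPh := (dirD_vNull_vPh_comm (M := M) (k := k) (σ := σ) hrp hdPh hp).trans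
    (dirD_congr hs hPh hp)
  unfold ang
  rw [dirD_add hs (smoothOn_sub (smoothOn_sub h1 h2) (smoothOn_const_smul _ h3)) h4 hp,
    dirD_sub hs (smoothOn_sub h1 h2) (smoothOn_const_smul _ h3) hp, dirD_sub hs h1 h2 hp,
    dirD_const_smul _ hs h3 hp, neg_mul, dirD_neg,
    dirD_polar_mul hX contDiffOn_inv_sin (contDiffOn_dTh hsdTh) hp,
    dirD_polar_mul hX contDiffOn_inv_sin_sq (contDiffOn_dPh hdPh) hp,
    dirD_polar_mul hX contDiffOn_cos_div_sin_sq hdPh hp,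
    dirD_polar_mul hX contDiffOn_ang_potential hU hp]
  simp only [Pi.add_apply, Pi.sub_apply, Pi.mul_apply, Pi.smul_apply, Pi.neg_apply, smul_eq_mul,
    hThTh, hPhPh, hPh hp]
  ring

section Bridge

theorem unc_dT (hU : ContDiffOn ℝ (⊤ : ℕ∞) U (OmSet rp)) (h : EqOn (unc u) U (OmSet rp)) :
    EqOn (unc (dT u)) (dirD vT U) (OmSet rp) := fun p hp => by
  have hd := differentiableAt_of_smoothOn (isOpen_OmSet rp) (hU.congr h) hp
  have hc : HasDerivAt (fun s : ℝ => (s, p.2)) ((1, 0) : ℝ × ℝ × ℝ × ℝ) p.1 :=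
    (hasDerivAt_id _).prodMk (hasDerivAt_const _ _)
  rw [← dirD_congr (isOpen_OmSet rp) h hp]
  exact (hd.hasFDerivAt.comp_hasDerivAt p.1 hc).deriv

theorem unc_dR (hU : ContDiffOn ℝ (⊤ : ℕ∞) U (OmSet rp)) (h : EqOn (unc u) U (OmSet rp)) :
    EqOn (unc (dR u)) (dirD vR U) (OmSet rp) := fun p hp => by
  have hd := differentiableAt_of_smoothOn (isOpen_OmSet rp) (hU.congr h) hp
  have hc : HasDerivAt (fun s : ℝ => (p.1, s, p.2.2)) ((0, 1, 0) : ℝ × ℝ × ℝ × ℝ) p.2.1 :=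
    (hasDerivAt_const _ _).prodMk ((hasDerivAt_id _).prodMk (hasDerivAt_const _ _))
  rw [← dirD_congr (isOpen_OmSet rp) h hp]
  exact (hd.hasFDerivAt.comp_hasDerivAt p.2.1 hc).deriv

theorem unc_dTh (hU : ContDiffOn ℝ (⊤ : ℕ∞) U (OmSet rp)) (h : EqOn (unc u) U (OmSet rp)) :
    EqOn (unc (dTh u)) (dirD vTh U) (OmSet rp) := fun p hp => by
  have hd := differentiableAt_of_smoothOn (isOpen_OmSet rp) (hU.congr h) hp
  have hc : HasDerivAt (fun s : ℝ => (p.1, p.2.1, s, p.2.2.2)) ((0, 0, 1, 0) : ℝ × ℝ × ℝ × ℝ)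
      p.2.2.1 :=
    (hasDerivAt_const _ _).prodMk ((hasDerivAt_const _ _).prodMk
      ((hasDerivAt_id _).prodMk (hasDerivAt_const _ _)))
  rw [← dirD_congr (isOpen_OmSet rp) h hp]
  exact (hd.hasFDerivAt.comp_hasDerivAt p.2.2.1 hc).deriv

theorem unc_dPh (hU : ContDiffOn ℝ (⊤ : ℕ∞) U (OmSet rp)) (h : EqOn (unc u) U (OmSet rp)) :
    EqOn (unc (dPh u)) (dirD vPh U) (OmSet rp) := fun p hp => by
  have hd := differentiableAt_of_smoothOn (isOpen_OmSet rp) (hU.congr h) hp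
  have hc : HasDerivAt (fun s : ℝ => (p.1, p.2.1, p.2.2.1, s)) ((0, 0, 0, 1) : ℝ × ℝ × ℝ × ℝ)
      p.2.2.2 :=
    (hasDerivAt_const _ _).prodMk ((hasDerivAt_const _ _).prodMk
      ((hasDerivAt_const _ _).prodMk (hasDerivAt_id _)))
  rw [← dirD_congr (isOpen_OmSet rp) h hp]
  exact (hd.hasFDerivAt.comp_hasDerivAt p.2.2.2 hc).deriv

theorem dirD_vNull_eq (U : ℝ × ℝ × ℝ × ℝ → ℂ) (p : ℝ × ℝ × ℝ × ℝ) :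
    dirD (vNull M k σ) U p
      = dirD vT U p + ((σ * (Del M k p.2.1 / p.2.1 ^ 2) : ℝ) : ℂ) * dirD vR U p := by
  have h : vNull M k σ p = vT p + (σ * (Del M k p.2.1 / p.2.1 ^ 2)) • vR p := by
    simp [vNull, vT, vR]
  simp only [dirD, h, map_add, map_smul, Complex.real_smul]

theorem unc_opL (hU : ContDiffOn ℝ (⊤ : ℕ∞) U (OmSet rp)) (h : EqOn (unc u) U (OmSet rp)) :
    EqOn (unc (opL M k u)) (dirD (vNull M k 1) U) (OmSet rp) := fun p hp => by
  rw [dirD_vNull_eq, ← unc_dT hU h hp, ← unc_dR hU h hp]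
  simp [unc, opL]

theorem unc_opLb (hU : ContDiffOn ℝ (⊤ : ℕ∞) U (OmSet rp)) (h : EqOn (unc u) U (OmSet rp)) :
    EqOn (unc (opLb M k u)) (dirD (vNull M k (-1)) U) (OmSet rp) := fun p hp => by
  rw [dirD_vNull_eq, ← unc_dT hU h hp, ← unc_dR hU h hp]
  simp [unc, opLb, sub_eq_add_neg]

theorem unc_winv (h : EqOn (unc u) U (OmSet rp)) :
    EqOn (unc (winv M k u)) (radial (fun r => (ww M k r)⁻¹) * U) (OmSet rp) := fun p hp => by
  simp [← h hp, unc, winv, radial]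

theorem unc_angP (hU : ContDiffOn ℝ (⊤ : ℕ∞) U (OmSet rp)) (h : EqOn (unc u) U (OmSet rp)) :
    EqOn (unc (angP u)) (ang U) (OmSet rp) := fun p hp => by
  have hsTh : EqOn (unc fun t r ϑ φ => (Real.sin ϑ : ℂ) * dTh u t r ϑ φ)
      (polar Real.sin * dirD vTh U) (OmSet rp) := fun q hq => by
    simp [← unc_dTh hU h hq, unc, polar]
  have h1 := unc_dTh (smoothOn_mul (contDiffOn_polar contDiffOn_sin) (contDiffOn_dTh hU)) hsTh hp
  have h2 := unc_dPh (contDiffOn_dPh hU) (unc_dPh hU h) hp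
  simp only [ang, Pi.add_apply, Pi.sub_apply, Pi.mul_apply, Pi.smul_apply, Pi.neg_apply,
    smul_eq_mul, ← h1, ← h2, ← unc_dPh hU h hp, ← h hp]
  simp only [unc, angP, polar, dTh]
  push_cast
  ring

theorem unc_ww_sq_mul (h : EqOn (unc u) U (OmSet rp)) :
    EqOn (unc fun t r ϑ φ => (((ww M k r) ^ 2 : ℝ) : ℂ) * u t r ϑ φ)
      (radial (fun r => ww M k r ^ 2) * U) (OmSet rp) := fun p hp => by
  simp [← h hp, unc, radial]

theorem unc_angSqP (hU : ContDiffOn ℝ (⊤ : ℕ∞) U (OmSet rp)) (h : EqOn (unc u) U (OmSet rp)) :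
    EqOn (unc (angSqP u)) (ang (ang U - radial (fun _ => 2) * U)) (OmSet rp) := by
  refine unc_angP (smoothOn_sub (contDiffOn_ang hU)
    (smoothOn_mul (contDiffOn_radial contDiffOn_const) hU)) fun q hq => ?_
  simp only [Pi.sub_apply, Pi.mul_apply, ← unc_angP hU h hq, ← h hq]
  simp [unc, radial]

theorem unc_RWp (hrp : 0 < rp) (hU : ContDiffOn ℝ (⊤ : ℕ∞) U (OmSet rp))
    (h : EqOn (unc u) U (OmSet rp)) :
    EqOn (unc (RWp M k u))
      (radial (ww M k) * (radial (fun r => 6 * M / r) * U - ang U)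
        - dirD (vNull M k 1) (dirD (vNull M k (-1)) U)) (OmSet rp) := fun p hp => by
  have h1 := unc_opL (M := M) (k := k) (contDiffOn_dNull hrp hU)
    (unc_opLb (M := M) (k := k) hU h) hp
  simp only [Pi.mul_apply, Pi.sub_apply, ← h1, ← unc_angP hU h hp, ← h hp]
  simp only [unc, radial, RWp]
  ring

end Bridge

section Coefficients

theorem ww_pos (hrp : 0 < rp) (hroot : rp + k ^ 2 * rp ^ 3 - 2 * M = 0) {r : ℝ} (hr : rp < r) :
    0 < ww M k r := by
  have hr0 : 0 < r := hrp.trans hr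
  have h3 : rp ^ 3 ≤ r ^ 3 := by gcongr
  have h : 0 < r + k ^ 2 * r ^ 3 - 2 * M := by
    nlinarith [mul_le_mul_of_nonneg_left h3 (sq_nonneg k)]
  have : Del M k r = r * (r + k ^ 2 * r ^ 3 - 2 * M) := by unfold Del; ring
  unfold ww
  rw [this]
  positivity

theorem contDiffOn_ww (hrp : 0 < rp) : ContDiffOn ℝ (⊤ : ℕ∞) (ww M k) (Ioi rp) := by
  unfold ww Del
  exact ContDiffOn.div (by fun_prop) (by fun_prop)
    fun r hr => pow_ne_zero 4 (hrp.trans hr).ne'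

theorem contDiffOn_inv_ww (hrp : 0 < rp) (hroot : rp + k ^ 2 * rp ^ 3 - 2 * M = 0) :
    ContDiffOn ℝ (⊤ : ℕ∞) (fun r => (ww M k r)⁻¹) (Ioi rp) :=
  (contDiffOn_ww hrp).inv fun _ hr => (ww_pos hrp hroot hr).ne'

theorem contDiffOn_const_div (c : ℝ) (hrp : 0 < rp) :
    ContDiffOn ℝ (⊤ : ℕ∞) (fun r => c / r) (Ioi rp) :=
  contDiffOn_const.div contDiffOn_id fun _ hr => ne_of_gt (hrp.trans hr)

/-- The logarithmic derivative `w′/w = 6M/r² − 2/r`. -/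
def wLogDeriv (M r : ℝ) : ℝ := 6 * M / r ^ 2 - 2 / r

theorem contDiffOn_wLogDeriv (hrp : 0 < rp) : ContDiffOn ℝ (⊤ : ℕ∞) (wLogDeriv M) (Ioi rp) :=
  (contDiffOn_const.div (contDiffOn_id.pow 2) fun _ hr => pow_ne_zero 2 (hrp.trans hr).ne').sub
    (contDiffOn_const_div 2 hrp)

theorem hasDerivAt_ww {r : ℝ} (hr : r ≠ 0) : HasDerivAt (ww M k) (wLogDeriv M r / r ^ 2) r := by
  unfold ww Del wLogDeriv
  have h := ((((hasDerivAt_id r).pow 2).add (((hasDerivAt_id r).pow 4).const_mul (k ^ 2))).sub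
    ((hasDerivAt_id r).const_mul (2 * M))).div ((hasDerivAt_id r).pow 4) (pow_ne_zero 4 hr)
  refine h.congr_deriv ?_
  simp only [id, Pi.add_apply, Pi.sub_apply, Pi.pow_apply]
  field_simp
  ring

theorem hasDerivAt_const_div (c : ℝ) {r : ℝ} (hr : r ≠ 0) :
    HasDerivAt (fun r => c / r) (-c / r ^ 2) r := by
  have h := (hasDerivAt_inv hr).const_mul c
  refine (h.congr_deriv ?_).congr_of_eventuallyEq (.of_forall fun x => div_eq_mul_inv c x)
  field_simp

theorem hasDerivAt_wLogDeriv {r : ℝ} (hr : r ≠ 0) :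
    HasDerivAt (wLogDeriv M) ((2 - 2 * (6 * M / r)) / r ^ 2) r := by
  have h := ((hasDerivAt_const r (6 * M)).div ((hasDerivAt_id r).pow 2) (pow_ne_zero 2 hr)).sub
    (hasDerivAt_const_div 2 hr)
  refine h.congr_deriv ?_
  simp only [id, Pi.pow_apply]
  field_simp
  ring

theorem lapse_eq {r : ℝ} (hr : r ≠ 0) : Del M k r / r ^ 2 = r ^ 2 * ww M k r := by
  unfold ww
  field_simp

/-- `f ∂ᵣ g` for the lapse `f = Δ/r² = r²w`, when `∂ᵣ g = c/r²`. -/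
theorem dirD_vNull_radial_mul {c : ℝ} (hrp : 0 < rp) (hg : ContDiffOn ℝ (⊤ : ℕ∞) g (Ioi rp))
    (hg' : HasDerivAt g (c / p.2.1 ^ 2) p.2.1)
    (hU : ContDiffOn ℝ (⊤ : ℕ∞) U (OmSet rp)) (hp : p ∈ OmSet rp) :
    dirD (vNull M k σ) (radial g * U) p
      = radial g p * dirD (vNull M k σ) U p + (σ * c * ww M k p.2.1 : ℝ) * U p := by
  have hr : p.2.1 ≠ 0 := (hrp.trans hp.1).ne'
  rw [dirD_radial_mul hg hg' hU hp]
  have : c / p.2.1 ^ 2 * (vNull M k σ p).2.1 = σ * c * ww M k p.2.1 := by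
    simp only [vNull, lapse_eq hr]
    field_simp
  rw [this]

end Coefficients

section ReggeWheeler

/-- `w²(w⁻¹L)²U = LLU − (w′/w)LU`, and likewise for `L̲`. -/
theorem ww_sq_mul_null_null (hrp : 0 < rp) (hroot : rp + k ^ 2 * rp ^ 3 - 2 * M = 0)
    (hU : ContDiffOn ℝ (⊤ : ℕ∞) U (OmSet rp)) :
    EqOn (radial (fun r => ww M k r ^ 2) * (radial (fun r => (ww M k r)⁻¹) *
        dirD (vNull M k σ) (radial (fun r => (ww M k r)⁻¹) * dirD (vNull M k σ) U)))
      (dirD (vNull M k σ) (dirD (vNull M k σ) U)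
        - (σ : ℂ) • (radial (wLogDeriv M) * dirD (vNull M k σ) U)) (OmSet rp) := fun p hp => by
  have hr : p.2.1 ≠ 0 := (hrp.trans hp.1).ne'
  have hw : ww M k p.2.1 ≠ 0 := (ww_pos hrp hroot hp.1).ne'
  have hwC : (ww M k p.2.1 : ℂ) ≠ 0 := by exact_mod_cast hw
  have hder : HasDerivAt (fun r => (ww M k r)⁻¹)
      (-wLogDeriv M p.2.1 / ww M k p.2.1 ^ 2 / p.2.1 ^ 2) p.2.1 :=
    ((hasDerivAt_ww hr).inv hw).congr_deriv (by ring)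
  simp only [Pi.mul_apply, Pi.sub_apply, Pi.smul_apply, smul_eq_mul]
  rw [dirD_vNull_radial_mul hrp (contDiffOn_inv_ww hrp hroot) hder (contDiffOn_dNull hrp hU) hp]
  simp only [radial]
  push_cast
  field_simp
  ring

/-- `w⁻¹L̲(LLU − (w′/w)LU) = −(𝓛 − 2 + 6M/r)LU − 6MwU` for a solution `U` of the Regge–Wheeler
equation, and likewise with the roles of `L` and `L̲` exchanged. -/
theorem null_transformed (hrp : 0 < rp) (hroot : rp + k ^ 2 * rp ^ 3 - 2 * M = 0)
    (hU : ContDiffOn ℝ (⊤ : ℕ∞) U (OmSet rp)) (hσ : σ * σ = 1)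
    (hRW : EqOn (dirD (vNull M k σ) (dirD (vNull M k (-σ)) U))
      (radial (ww M k) * (radial (fun r => 6 * M / r) * U - ang U)) (OmSet rp)) :
    EqOn (radial (fun r => (ww M k r)⁻¹) * dirD (vNull M k (-σ))
        (dirD (vNull M k σ) (dirD (vNull M k σ) U)
          - (σ : ℂ) • (radial (wLogDeriv M) * dirD (vNull M k σ) U)))
      (radial (fun _ => 2) * dirD (vNull M k σ) U
        - radial (fun r => 6 * M / r) * dirD (vNull M k σ) U - ang (dirD (vNull M k σ) U)
        - ((6 * M * σ : ℝ) : ℂ) • (radial (ww M k) * U)) (OmSet rp) := fun p hp => by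
  have hs := isOpen_OmSet rp
  have hr : p.2.1 ≠ 0 := (hrp.trans hp.1).ne'
  have hwC : (ww M k p.2.1 : ℂ) ≠ 0 := by exact_mod_cast (ww_pos hrp hroot hp.1).ne'
  have hq := contDiffOn_const_div (6 * M) hrp
  have hS : ContDiffOn ℝ (⊤ : ℕ∞) (dirD (vNull M k σ) U) (OmSet rp) := contDiffOn_dNull hrp hU
  have hqU := smoothOn_mul (contDiffOn_radial hq) hU
  have hLB := smoothOn_mul (contDiffOn_radial (contDiffOn_wLogDeriv (M := M) hrp)) hS
  have hTS : EqOn (dirD (vNull M k (-σ)) (dirD (vNull M k σ) U))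
      (radial (ww M k) * (radial (fun r => 6 * M / r) * U - ang U)) (OmSet rp) :=
    (dirD_vNull_comm hrp hU).trans hRW
  have hTSS : dirD (vNull M k (-σ)) (dirD (vNull M k σ) (dirD (vNull M k σ) U)) p = _ :=
    (dirD_vNull_comm hrp hS hp).trans (dirD_congr hs hTS hp)
  rw [dirD_vNull_radial_mul hrp (contDiffOn_ww hrp) (hasDerivAt_ww hr)
      (smoothOn_sub hqU (contDiffOn_ang hU)) hp,
    dirD_sub hs hqU (contDiffOn_ang hU) hp,
    dirD_vNull_radial_mul hrp hq (hasDerivAt_const_div _ hr) hU hp,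
    dirD_vNull_ang hrp hU hp] at hTSS
  simp only [Pi.mul_apply, Pi.sub_apply, Pi.smul_apply, smul_eq_mul]
  rw [dirD_sub hs (contDiffOn_dNull hrp hS) (smoothOn_const_smul _ hLB) hp,
    dirD_const_smul _ hs hLB hp, hTSS,
    dirD_vNull_radial_mul hrp (contDiffOn_wLogDeriv hrp) (hasDerivAt_wLogDeriv hr) hS hp, hTS hp]
  have hσC : (σ : ℂ) ^ 2 = 1 := by exact_mod_cast (sq σ).trans hσ
  simp only [radial, Pi.mul_apply, Pi.sub_apply]
  push_cast
  field_simp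
  ring_nf
  simp only [hσC]
  ring

/-- The transformation identity, with `L` for `σ = 1` and `L̲` for `σ = -1`. -/
theorem null_transformation_identity (hrp : 0 < rp)
    (hroot : rp + k ^ 2 * rp ^ 3 - 2 * M = 0)
    (hU : ContDiffOn ℝ (⊤ : ℕ∞) U (OmSet rp)) (hσ : σ * σ = 1)
    (hRW : EqOn (dirD (vNull M k σ) (dirD (vNull M k (-σ)) U))
      (radial (ww M k) * (radial (fun r => 6 * M / r) * U - ang U)) (OmSet rp)) :
    EqOn (radial (fun r => (ww M k r)⁻¹) * dirD (vNull M k (-σ))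
        (radial (fun r => (ww M k r)⁻¹) * dirD (vNull M k (-σ))
          (radial (fun r => ww M k r ^ 2) * (radial (fun r => (ww M k r)⁻¹) *
            dirD (vNull M k σ) (radial (fun r => (ww M k r)⁻¹) * dirD (vNull M k σ) U)))))
      (ang (ang U - radial (fun _ => 2) * U) - ((12 * M * σ : ℝ) : ℂ) • dirD vT U)
      (OmSet rp) := fun p hp => by
  have hs := isOpen_OmSet rp
  have hr : p.2.1 ≠ 0 := (hrp.trans hp.1).ne'
  have hwC : (ww M k p.2.1 : ℂ) ≠ 0 := by exact_mod_cast (ww_pos hrp hroot hp.1).ne'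
  have hrC : (p.2.1 : ℂ) ≠ 0 := by exact_mod_cast hr
  have hq := contDiffOn_const_div (6 * M) hrp
  have h2 : ContDiffOn ℝ (⊤ : ℕ∞) (fun _ : ℝ => (2 : ℝ)) (Ioi rp) := contDiffOn_const
  have hS : ContDiffOn ℝ (⊤ : ℕ∞) (dirD (vNull M k σ) U) (OmSet rp) := contDiffOn_dNull hrp hU
  have hA := contDiffOn_ang hU
  have hqU := smoothOn_mul (contDiffOn_radial hq) hU
  have hqS := smoothOn_mul (contDiffOn_radial hq) hS
  have h2S := smoothOn_mul (contDiffOn_radial h2) hS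
  have hwU := smoothOn_mul (contDiffOn_radial (contDiffOn_ww (M := M) (k := k) hrp)) hU
  have hTS : EqOn (dirD (vNull M k (-σ)) (dirD (vNull M k σ) U))
      (radial (ww M k) * (radial (fun r => 6 * M / r) * U - ang U)) (OmSet rp) :=
    (dirD_vNull_comm hrp hU).trans hRW
  have hangTS := (ang_congr hTS).trans
    (ang_radial_mul (contDiffOn_ww hrp) (smoothOn_sub hqU hA)) hp
  rw [Pi.mul_apply, ang_sub hqU hA hp, Pi.sub_apply, ang_radial_mul hq hU hp] at hangTS
  have hinner : EqOn _ _ (OmSet rp) := fun q hq => (congrArg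
    (radial (fun r => (ww M k r)⁻¹) q * ·) (dirD_congr (X := vNull M k (-σ)) hs
      (ww_sq_mul_null_null (σ := σ) hrp hroot hU) hq)).trans
        (null_transformed hrp hroot hU hσ hRW hq)
  have hT := dirD_congr (X := vNull M k (-σ)) hs hinner hp
  have hder2 : HasDerivAt (fun _ : ℝ => (2 : ℝ)) (0 / p.2.1 ^ 2) p.2.1 := by
    simpa using hasDerivAt_const p.2.1 (2 : ℝ)
  rw [dirD_sub hs (smoothOn_sub (smoothOn_sub h2S hqS) (contDiffOn_ang hS))
      (smoothOn_const_smul _ hwU) hp,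
    dirD_sub hs (smoothOn_sub h2S hqS) (contDiffOn_ang hS) hp, dirD_sub hs h2S hqS hp,
    dirD_const_smul _ hs hwU hp, dirD_vNull_ang hrp hS hp,
    dirD_vNull_radial_mul hrp h2 hder2 hS hp,
    dirD_vNull_radial_mul hrp hq (hasDerivAt_const_div _ hr) hS hp,
    dirD_vNull_radial_mul hrp (contDiffOn_ww hrp) (hasDerivAt_ww hr) hU hp, hangTS, hTS hp] at hT
  have hσC : (σ : ℂ) ^ 2 = 1 := by exact_mod_cast (sq σ).trans hσ
  simp only [Pi.mul_apply, Pi.sub_apply, Pi.smul_apply, smul_eq_mul]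
  refine (congrArg (radial (fun r => (ww M k r)⁻¹) p * ·) hT).trans ?_
  rw [ang_sub hA (smoothOn_mul (contDiffOn_radial h2) hU) hp, Pi.sub_apply,
    ang_radial_mul h2 hU hp, dirD_vNull_eq U p, dirD_vNull_eq U p]
  simp only [radial, Pi.mul_apply, Pi.sub_apply, wLogDeriv]
  push_cast
  field_simp
  ring_nf
  simp only [hσC]
  ring

end ReggeWheeler

end Exterior

/-- For a solution `Ψ` of the Regge–Wheeler equation `𝕽⁽⁺²⁾Ψ = 0`:
`(w⁻¹L̲)²(w²(w⁻¹L)²Ψ) = (𝓛(𝓛−2) − 12M∂ₜ)Ψ` and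
`(w⁻¹L)²(w²(w⁻¹L̲)²Ψ) = (𝓛(𝓛−2) + 12M∂ₜ)Ψ` on `Ω`, with `𝓛 = 𝓛⁽⁺²⁾`. -/
theorem statement9
    (M k rp : ℝ) (hM : 0 < M) (hk : 0 < k) (hrp : 0 < rp)
    (hroot : rp + k ^ 2 * rp ^ 3 - 2 * M = 0)
    (Ψ : F4) (hΨ : SmoothOnOm rp Ψ)
    (hRW : ∀ t r ϑ φ : ℝ, (t, r, ϑ, φ) ∈ OmSet rp → RWp M k Ψ t r ϑ φ = 0) :
    ∀ t r ϑ φ : ℝ, (t, r, ϑ, φ) ∈ OmSet rp →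
      winv M k (opLb M k (winv M k (opLb M k (fun t r ϑ φ =>
          (((ww M k r) ^ 2 : ℝ) : ℂ) *
            winv M k (opL M k (winv M k (opL M k Ψ))) t r ϑ φ)))) t r ϑ φ
        = angSqP Ψ t r ϑ φ - 12 * (M : ℂ) * dT Ψ t r ϑ φ
      ∧
      winv M k (opL M k (winv M k (opL M k (fun t r ϑ φ =>
          (((ww M k r) ^ 2 : ℝ) : ℂ) *
            winv M k (opLb M k (winv M k (opLb M k Ψ))) t r ϑ φ)))) t r ϑ φ
        = angSqP Ψ t r ϑ φ + 12 * (M : ℂ) * dT Ψ t r ϑ φ := by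
  have hU : ContDiffOn ℝ (⊤ : ℕ∞) (unc Ψ) (OmSet rp) := hΨ
  have hrefl : EqOn (unc Ψ) (unc Ψ) (OmSet rp) := eqOn_refl _ _
  have hI := contDiffOn_radial (contDiffOn_inv_ww hrp hroot)
  have hw2 := contDiffOn_radial ((contDiffOn_ww (M := M) (k := k) hrp).pow 2)
  have hwinv (τ : ℝ) {V : ℝ × ℝ × ℝ × ℝ → ℂ} (hV : ContDiffOn ℝ (⊤ : ℕ∞) V (OmSet rp)) :
      ContDiffOn ℝ (⊤ : ℕ∞) (radial (fun r => (ww M k r)⁻¹) * dirD (vNull M k τ) V) (OmSet rp) :=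
    smoothOn_mul hI (contDiffOn_dNull hrp hV)
  have hL {u : F4} {V : ℝ × ℝ × ℝ × ℝ → ℂ} (hV : ContDiffOn ℝ (⊤ : ℕ∞) V (OmSet rp))
      (h : EqOn (unc u) V (OmSet rp)) : EqOn (unc (winv M k (opL M k u)))
        (radial (fun r => (ww M k r)⁻¹) * dirD (vNull M k 1) V) (OmSet rp) :=
    unc_winv (unc_opL hV h)
  have hLb {u : F4} {V : ℝ × ℝ × ℝ × ℝ → ℂ} (hV : ContDiffOn ℝ (⊤ : ℕ∞) V (OmSet rp))
      (h : EqOn (unc u) V (OmSet rp)) : EqOn (unc (winv M k (opLb M k u)))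
        (radial (fun r => (ww M k r)⁻¹) * dirD (vNull M k (-1)) V) (OmSet rp) :=
    unc_winv (unc_opLb hV h)
  have hRW_L : EqOn (dirD (vNull M k 1) (dirD (vNull M k (-1)) (unc Ψ)))
      (radial (ww M k) * (radial (fun r => 6 * M / r) * unc Ψ - ang (unc Ψ))) (OmSet rp) :=
    fun q hq => (sub_eq_zero.1 ((unc_RWp hrp hU hrefl hq).symm.trans
      (hRW q.1 q.2.1 q.2.2.1 q.2.2.2 hq))).symm
  have hRW_Lb : EqOn (dirD (vNull M k (-1)) (dirD (vNull M k (-(-1))) (unc Ψ)))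
      (radial (ww M k) * (radial (fun r => 6 * M / r) * unc Ψ - ang (unc Ψ))) (OmSet rp) := by
    rw [neg_neg]
    exact (dirD_vNull_comm hrp hU).trans hRW_L
  intro t r ϑ φ hp
  rw [← unc_apply (angSqP Ψ), ← unc_apply (dT Ψ), unc_angSqP hU hrefl hp, unc_dT hU hrefl hp]
  constructor
  · have hV := smoothOn_mul hw2 (hwinv 1 (hwinv 1 hU))
    have hlhs := hLb (hwinv (-1) hV) (hLb hV (unc_ww_sq_mul (M := M) (k := k)
      (hL (hwinv 1 hU) (hL hU hrefl)))) hp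
    have hid := null_transformation_identity hrp hroot hU (one_mul 1) hRW_L hp
    rw [← hlhs, unc_apply] at hid
    rw [hid]
    simp
  · have hV := smoothOn_mul hw2 (hwinv (-1) (hwinv (-1) hU))
    have hlhs := hL (hwinv 1 hV) (hL hV (unc_ww_sq_mul (M := M) (k := k)
      (hLb (hwinv (-1) hU) (hLb hU hrefl)))) hp
    have hid := null_transformation_identity hrp hroot hU (by norm_num) hRW_Lb hp
    rw [neg_neg, ← hlhs, unc_apply] at hid
    rw [hid]
    simp

end Grav
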